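/- arXiv:1803.01435 — 4 statements merged into one kernel-verified Lean document; each statement's English description precedes it below -/
import Mathlib

section
/- Suppose the triple (a, b, c) ∈ F_q³ satisfies a ≠ 0 and b² − 4ac ≠ 0. Let l₁, …, l_r (r ≥ 1) be distinct primes dividing q − 1 and set L = l₁·l₂⋯l_r. Then N(L, L) ≥ Σ_{j=1}^{r} [ N(l_j, 1) + N(1, l_j) ] − (2r − 1)·N(1, 1). -/
/-- `g` is `e`-free: `g ≠ 0` and whenever `g = h^d` with `d ∣ e`, we have `d = 1`. -/
def EFree {F : Type*} [Field F] [Fintype F] (e : ℕ) (g : F) : Prop :=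
  g ≠ 0 ∧ ∀ d : ℕ, d ∣ e → (∃ h : F, g = h ^ d) → d = 1

/-- `N(e₁, e₂)`: the number of `g ∈ F_q^×` such that `g` is `e₁`-free and
`a·g² + b·g + c` is `e₂`-free. -/
noncomputable def NN {F : Type*} [Field F] [Fintype F] (a b c : F) (e₁ e₂ : ℕ) : ℕ :=
  Set.ncard {g : F | EFree e₁ g ∧ EFree e₂ (a * g ^ 2 + b * g + c)}

section

variable {F : Type*} [Field F] [Fintype F]

theorem eFree_one_iff {g : F} : EFree 1 g ↔ g ≠ 0 :=
  ⟨fun h => h.1, fun h => ⟨h, fun _ hd _ => Nat.dvd_one.1 hd⟩⟩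

theorem EFree.eFree_one {e : ℕ} {g : F} (h : EFree e g) : EFree 1 g :=
  eFree_one_iff.2 h.1

/-- A nonzero element that is `l`-free for every prime `l` in a finite set is free for the
product of these primes. -/
theorem eFree_prod {ls : Finset ℕ} (hls : ∀ l ∈ ls, l.Prime) {g : F} (hg : g ≠ 0)
    (h : ∀ l ∈ ls, EFree l g) : EFree (∏ l ∈ ls, l) g := by
  refine ⟨hg, fun d hd ⟨x, hx⟩ => ?_⟩
  by_contra hne
  obtain ⟨p, hp, k, rfl⟩ := Nat.exists_prime_and_dvd hne
  obtain ⟨l, hl, hpl⟩ := (hp.prime.dvd_finsetProd_iff _).1 ((dvd_mul_right p k).trans hd)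
  obtain rfl := (Nat.prime_dvd_prime_iff_eq hp (hls l hl)).1 hpl
  exact hp.one_lt.ne' ((h p hl).2 p dvd_rfl ⟨x ^ k, by rw [hx, ← pow_mul, mul_comm]⟩)

end

/-- The union bound: if every element of `S` outside all the complements of `A i` and `B i`
lies in `T`, then `T` has at least `|S|` minus the sizes of these complements elements. -/
theorem sum_card_sub_le_card {α ι : Type*} [DecidableEq α] (s : Finset ι) (S T : Finset α)
    (A B : ι → Finset α) (hA : ∀ i ∈ s, A i ⊆ S) (hB : ∀ i ∈ s, B i ⊆ S)
    (hT : ∀ x ∈ S, (∀ i ∈ s, x ∈ A i ∧ x ∈ B i) → x ∈ T) :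
    (∑ i ∈ s, (((A i).card : ℤ) + ((B i).card : ℤ))) - (2 * (s.card : ℤ) - 1) * (S.card : ℤ)
      ≤ (T.card : ℤ) := by
  have hcover : S ⊆ T ∪ s.biUnion fun i => (S \ A i) ∪ (S \ B i) := by
    intro x hx
    by_cases h : ∀ i ∈ s, x ∈ A i ∧ x ∈ B i
    · exact Finset.mem_union_left _ (hT x hx h)
    · push Not at h
      obtain ⟨i, hi, h⟩ := h
      refine Finset.mem_union_right _ (Finset.mem_biUnion.2 ⟨i, hi, ?_⟩)
      simp only [Finset.mem_union, Finset.mem_sdiff]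
      tauto
  have hcard : S.card ≤ T.card + ∑ i ∈ s, ((S \ A i).card + (S \ B i).card) :=
    (Finset.card_le_card hcover).trans <| (Finset.card_union_le _ _).trans <|
      Nat.add_le_add_left (Finset.card_biUnion_le.trans
        (Finset.sum_le_sum fun _ _ => Finset.card_union_le _ _)) _
  have hsum : ∑ i ∈ s, (((S \ A i).card : ℤ) + ((S \ B i).card : ℤ))
      = 2 * s.card * S.card - ∑ i ∈ s, (((A i).card : ℤ) + ((B i).card : ℤ)) := by
    have hconst : ∑ _i ∈ s, (2 * (S.card : ℤ)) = 2 * s.card * S.card := by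
      rw [Finset.sum_const, nsmul_eq_mul]
      ring
    rw [← hconst, ← Finset.sum_sub_distrib]
    refine Finset.sum_congr rfl fun i hi => ?_
    have h₁ := Finset.card_sdiff_add_card_eq_card (hA i hi)
    have h₂ := Finset.card_sdiff_add_card_eq_card (hB i hi)
    omega
  zify at hcard
  rw [hsum] at hcard
  linarith

/-- **inequality (10).** Let `l₁, …, l_r` (`r ≥ 1`) be distinct primes
dividing `q − 1` and `L = l₁·l₂⋯l_r`. Then
`N(L, L) ≥ Σ_j [N(l_j, 1) + N(1, l_j)] − (2r − 1)·N(1, 1)`. -/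
theorem stmt_9 (F : Type*) [Field F] [Fintype F]
    (a b c : F) (ha : a ≠ 0) (hdisc : b ^ 2 - 4 * a * c ≠ 0)
    (ls : Finset ℕ) (hls : ∀ l ∈ ls, l.Prime ∧ l ∣ Fintype.card F - 1)
    (hr : 1 ≤ ls.card) :
    (∑ l ∈ ls, ((NN a b c l 1 : ℤ) + (NN a b c 1 l : ℤ)))
        - (2 * (ls.card : ℤ) - 1) * (NN a b c 1 1 : ℤ)
      ≤ (NN a b c (∏ l ∈ ls, l) (∏ l ∈ ls, l) : ℤ) := by
  classical
  let X (m n : ℕ) : Finset F := {g | EFree m g ∧ EFree n (a * g ^ 2 + b * g + c)}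
  have hX (m n : ℕ) : NN a b c m n = (X m n).card := by
    rw [NN, ← Set.ncard_coe_finset]
    congr 1
    ext g
    simp [X]
  have hmem {m n : ℕ} {g : F} :
      g ∈ X m n ↔ EFree m g ∧ EFree n (a * g ^ 2 + b * g + c) := by simp [X]
  have hsub (m n : ℕ) : X m n ⊆ X 1 1 := fun g hg =>
    hmem.2 ⟨(hmem.1 hg).1.eFree_one, (hmem.1 hg).2.eFree_one⟩
  simp only [hX]
  refine sum_card_sub_le_card ls _ _ (fun l => X l 1) (fun l => X 1 l)
    (fun l _ => hsub l 1) (fun l _ => hsub 1 l) fun g hg h => hmem.2 ⟨?_, ?_⟩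
  · exact eFree_prod (fun l hl => (hls l hl).1) (hmem.1 hg).1.1
      fun l hl => (hmem.1 (h l hl).1).1
  · exact eFree_prod (fun l hl => (hls l hl).1) (hmem.1 hg).2.1
      fun l hl => (hmem.1 (h l hl).2).2
end

section
/- Let q be an odd prime power, g a fixed primitive root of F_q, and d an odd unitary divisor of q − 1, i.e. d | q − 1, d is odd, and gcd(d, (q−1)/d) = 1. Let e be the product of the distinct primes dividing (q−1)/d, set A_d = { g^{n·d} : 0 ≤ n < e }, and for each divisor k of q − 1 let H_k = ⟨g^k⟩ be the unique subgroup of F_q^× of index k. Then every element of F_q^× can be written uniquely in the form α·h·h′ with α ∈ A_d, h ∈ H_{d·e}, and h′ ∈ H_{(q−1)/d}. -/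
/-- In a commutative group generated by an element `g` of order `d * m` with `d` and `m` coprime,
every element factors uniquely through `{g ^ (n * d) : n < e}`, `⟨g ^ (d * e)⟩` and `⟨g ^ m⟩`,
for each positive divisor `e` of `m`. -/
theorem existsUnique_mul_mul_of_orderOf_eq {G : Type*} [CommGroup G] (g : G)
    (hg : ∀ x : G, x ∈ Subgroup.zpowers g) (d m e : ℕ) (hord : orderOf g = d * m)
    (hd : d ≠ 0) (hdm : Nat.Coprime d m) (he : 0 < e) (hem : e ∣ m) (x : G) :
    ∃! t : G × G × G,
      (∃ n < e, t.1 = g ^ (n * d)) ∧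
      t.2.1 ∈ Subgroup.zpowers (g ^ (d * e)) ∧
      t.2.2 ∈ Subgroup.zpowers (g ^ m) ∧
      x = t.1 * t.2.1 * t.2.2 := by
  have hexp (n : ℕ) (s b : ℤ) : g ^ (n * d) * (g ^ (d * e)) ^ s * (g ^ m) ^ b =
      g ^ ((n : ℤ) * d + d * e * s + m * b) := by
    simp only [zpow_add, zpow_mul, ← zpow_natCast, Nat.cast_mul]
  apply existsUnique_of_exists_of_unique
  · obtain ⟨k, rfl⟩ := Subgroup.mem_zpowers_iff.mp (hg x)
    obtain ⟨u, v, huv⟩ := Nat.isCoprime_iff_coprime.mpr hdm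
    have he' : (0 : ℤ) < e := by exact_mod_cast he
    have hnn : ((k * u % e).toNat : ℤ) = k * u % e :=
      Int.toNat_of_nonneg (Int.emod_nonneg _ he'.ne')
    refine ⟨(g ^ ((k * u % e).toNat * d), (g ^ (d * e)) ^ (k * u / e), (g ^ m) ^ (k * v)),
      ⟨_, ?_, rfl⟩, Subgroup.zpow_mem_zpowers _ _, Subgroup.zpow_mem_zpowers _ _, ?_⟩
    · have := Int.emod_lt_of_pos (k * u) he'
      omega
    · rw [hexp, hnn]
      congr 1
      linear_combination (-k) * huv - (d : ℤ) * Int.emod_add_mul_ediv (k * u) e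
  · rintro ⟨_, _, _⟩ ⟨_, _, _⟩ ⟨⟨n, hn, rfl⟩, ⟨s, rfl⟩, ⟨b, rfl⟩, h⟩
      ⟨⟨n', hn', rfl⟩, ⟨s', rfl⟩, ⟨b', rfl⟩, h'⟩
    have heq := h.symm.trans h'
    simp only [hexp] at heq
    rw [zpow_eq_zpow_iff_modEq, hord, Int.modEq_iff_dvd] at heq
    push_cast at heq
    have hcop : IsCoprime (d : ℤ) m := Nat.isCoprime_iff_coprime.mpr hdm
    have hb : (d : ℤ) ∣ b' - b := by
      refine hcop.dvd_of_dvd_mul_left ?_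
      obtain ⟨c, hc⟩ := heq
      exact ⟨m * c - (n' - n) - e * (s' - s), by linear_combination hc⟩
    have hgb : (g ^ m) ^ b = (g ^ m) ^ b' := by
      rw [← zpow_natCast, ← zpow_mul, ← zpow_mul, zpow_eq_zpow_iff_modEq, hord,
        Int.modEq_iff_dvd]
      obtain ⟨c, hc⟩ := hb
      exact ⟨c, by push_cast; linear_combination (m : ℤ) * hc⟩
    have hnn : (e : ℤ) ∣ n' - n := by
      obtain ⟨c, hc⟩ := heq
      obtain ⟨a, ha⟩ := hb
      obtain ⟨f, rfl⟩ := hem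
      have hd' : (d : ℤ) ≠ 0 := by exact_mod_cast hd
      refine ⟨f * c - (s' - s) - f * a, mul_left_cancel₀ hd' ?_⟩
      push_cast at hc
      linear_combination hc - (e : ℤ) * f * ha
    have hn_eq : n = n' :=
      Nat.ModEq.eq_of_lt_of_lt ((Nat.modEq_iff_dvd).mpr hnn) hn hn'
    subst hn_eq
    have hs := h.symm.trans h'
    simp only [hgb, mul_left_inj, mul_right_inj] at hs
    simp only [Prod.mk.injEq]
    exact ⟨trivial, hs, hgb⟩


/-- **unique decomposition.** Let `q` be odd, `g` a primitive root of
`F_q` (a generator of `F_q^×`), and `d` an odd unitary divisor of `q − 1`. Let `e` be the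
product of the distinct primes dividing `(q−1)/d`, `A_d = {g^{nd} : 0 ≤ n < e}` and
`H_k = ⟨g^k⟩`. Then every `x ∈ F_q^×` can be written uniquely as `x = α·h·h′` with
`α ∈ A_d`, `h ∈ H_{de}` and `h′ ∈ H_{(q−1)/d}`. -/
theorem stmt_13 (F : Type*) [Field F] [Fintype F] (hodd : Odd (Fintype.card F))
    (g : Fˣ) (hg : ∀ x : Fˣ, x ∈ Subgroup.zpowers g)
    (d : ℕ) (hd : d ∣ Fintype.card F - 1) (hdodd : Odd d)
    (hunitary : Nat.Coprime d ((Fintype.card F - 1) / d))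
    (e : ℕ) (he : e = ∏ p ∈ ((Fintype.card F - 1) / d).primeFactors, p)
    (x : Fˣ) :
    ∃! t : Fˣ × Fˣ × Fˣ,
      (∃ n < e, t.1 = g ^ (n * d)) ∧
      t.2.1 ∈ Subgroup.zpowers (g ^ (d * e)) ∧
      t.2.2 ∈ Subgroup.zpowers (g ^ ((Fintype.card F - 1) / d)) ∧
      x = t.1 * t.2.1 * t.2.2 := by
  have hpos : 0 < Fintype.card F - 1 := Nat.sub_pos_of_lt Fintype.one_lt_card
  have hord : orderOf g = d * ((Fintype.card F - 1) / d) := by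
    rw [Nat.mul_div_cancel' hd, orderOf_eq_card_of_forall_mem_zpowers hg,
      Nat.card_units, Nat.card_eq_fintype_card]
  refine existsUnique_mul_mul_of_orderOf_eq g hg d _ e hord (Nat.pos_of_dvd_of_pos hd hpos).ne'
    hunitary ?_ ?_ x
  · rw [he]
    exact Finset.prod_pos fun p hp => (Nat.prime_of_mem_primeFactors hp).pos
  · rw [he]
    exact Nat.prod_primeFactors_dvd _
end

section
/- Let q be an odd prime power, g a fixed primitive root of F_q, and P ⊆ F_q^× the set of all primitive roots of F_q. Let d be an odd unitary divisor of q − 1 (d | q − 1, d odd, gcd(d, (q−1)/d) = 1), let e be the product of the distinct primes dividing (q−1)/d, set A_d = { g^{n·d} : 0 ≤ n < e }, and let S_d be the set of primes dividing d. For p ∈ S_d let r_p : F_q^× → Z/pZ send x to (log_g x) mod p, where log_g x is the unique integer n with 0 ≤ n < q − 1 and g^n = x, and let R_p = { n + pZ : 1 ≤ n ≤ (p−1)/2 }. For ε ∈ {±1}^{S_d} define X_d(ε) = { x ∈ F_q^× : r_p(x) ∈ ε_p·R_p ∪ {0} for all p ∈ S_d }. Suppose that for all α, β ∈ A_d and all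 ε, δ ∈ {±1}^{S_d} one has { (α·x + 1)² − β·y : x ∈ P ∩ X_d(ε), y ∈ P ∩ X_d(δ) } ⊇ F_q^×, and that for all β ∈ A_d and all δ ∈ {±1}^{S_d} one has { x² − β·y : x ∈ P, y ∈ P ∩ X_d(δ) } ⊇ F_q^×. Then for all a, b, c ∈ F_q with a ≠ 0 and b² − 4ac ≠ 0 there exist primitive roots x and y of F_q with y = a·x² + b·x + c. -/
/-- For every residue `t` modulo `p` there is a sign `ε` such that `-t` is not in `ε·R_p`, where
`R_p = {1, …, (p - 1) / 2}`. -/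
lemma exists_sign_forall_add_ne_zero (p : ℕ) (t : ZMod p) :
    ∃ ε : ℤˣ, ∀ m : ℕ, 1 ≤ m → m ≤ (p - 1) / 2 →
      t + ((ε : ℤ) : ZMod p) * (m : ZMod p) ≠ 0 := by
  by_cases h : ∃ k : ℕ, 1 ≤ k ∧ k ≤ (p - 1) / 2 ∧ t = (k : ZMod p)
  · obtain ⟨k, hk, hkp, rfl⟩ := h
    refine ⟨1, fun m hm hmp h0 => ?_⟩
    have h0' : ((k + m : ℕ) : ZMod p) = 0 := by simpa using h0
    have := Nat.le_of_dvd (by omega) ((ZMod.natCast_eq_zero_iff _ _).1 h0')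
    omega
  · refine ⟨-1, fun m hm hmp h0 => h ⟨m, hm, hmp, ?_⟩⟩
    have h0' : t - (m : ZMod p) = 0 := by simpa [sub_eq_add_neg] using h0
    exact sub_eq_zero.1 h0'

/-- If `d` and `e` are coprime and `e` is positive, then `n * d + s` is divisible by `e` for
some `n < e`. -/
lemma Nat.Coprime.exists_lt_dvd_mul_add {d e : ℕ} (h : Nat.Coprime d e) (he : 0 < e) (s : ℕ) :
    ∃ n < e, e ∣ n * d + s := by
  have : NeZero e := ⟨he.ne'⟩
  refine ⟨(-(s : ZMod e) * (d : ZMod e)⁻¹).val, ZMod.val_lt _, ?_⟩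
  rw [← ZMod.natCast_eq_zero_iff]
  push_cast
  rw [ZMod.natCast_zmod_val, mul_assoc, mul_comm _ (d : ZMod e), ZMod.coe_mul_inv_eq_one d h]
  ring

/-- A power of a generator `g` is a generator iff its exponent is coprime to the order of `g`. -/
lemma forall_mem_zpowers_pow_iff {G : Type*} [Group G] {g : G}
    (hg : ∀ x : G, x ∈ Subgroup.zpowers g) (k : ℕ) :
    (∀ z : G, z ∈ Subgroup.zpowers (g ^ k)) ↔ Nat.Coprime k (orderOf g) := by
  rw [Nat.coprime_iff_gcd_eq_one, ← mem_zpowers_pow_iff]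
  refine ⟨fun h => h g, fun h z => ?_⟩
  exact (Subgroup.zpowers_le.2 h) (hg z)

/-- Let `g` generate a finite cyclic group of order `N`, and let `d ∣ N` be coprime to `N / d`.
Every `k` can be corrected by some `g ^ (n * d)`, with `n` below the radical
of `N / d`, so that multiplication by the result sends generators with logarithms in the half
systems prescribed by suitable signs to generators. -/
lemma exists_pow_exists_sign_forall_mul_generator {G : Type*} [Group G] [Finite G] {g : G}
    (hg : ∀ x : G, x ∈ Subgroup.zpowers g) {d : ℕ} (hd : d ∣ orderOf g)
    (hunitary : Nat.Coprime d (orderOf g / d)) (k : G) :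
    ∃ n < ∏ p ∈ (orderOf g / d).primeFactors, p, ∃ ε : ℕ → ℤˣ, ∀ x : G,
      (∀ z : G, z ∈ Subgroup.zpowers x) →
      (∀ p ∈ d.primeFactors, ∃ l < orderOf g, g ^ l = x ∧
        ((l : ZMod p) = 0 ∨ ∃ m : ℕ, 1 ≤ m ∧ m ≤ (p - 1) / 2 ∧
          (l : ZMod p) = ((ε p : ℤ) : ZMod p) * (m : ZMod p))) →
      ∀ z : G, z ∈ Subgroup.zpowers (k * g ^ (n * d) * x) := by
  have hN : 0 < orderOf g := orderOf_pos g
  have hd0 : 0 < d := Nat.pos_of_dvd_of_pos hd hN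
  obtain ⟨s, rfl⟩ := mem_powers_iff_mem_zpowers.2 (hg k)
  have hcop : Nat.Coprime d (∏ p ∈ (orderOf g / d).primeFactors, p) :=
    hunitary.coprime_dvd_right (Nat.prod_primeFactors_dvd _)
  obtain ⟨n, hn, hdvd⟩ := hcop.exists_lt_dvd_mul_add
    (Finset.prod_pos fun p hp => (Nat.prime_of_mem_primeFactors hp).pos) s
  choose ε hε using fun p : ℕ => exists_sign_forall_add_ne_zero p ((n * d + s : ℕ) : ZMod p)
  refine ⟨n, hn, ε, fun x hxgen hxX => ?_⟩
  obtain ⟨j, rfl⟩ := mem_powers_iff_mem_zpowers.2 (hg x)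
  have hj : Nat.Coprime j (orderOf g) := (forall_mem_zpowers_pow_iff hg j).1 hxgen
  have hpow : g ^ s * g ^ (n * d) * g ^ j = g ^ (n * d + s + j) := by
    rw [← pow_add, ← pow_add, add_comm s]
  simp only [hpow]
  rw [forall_mem_zpowers_pow_iff hg]
  refine Nat.coprime_of_dvd fun p hp hpt hpN => ?_
  have hpj : ¬ p ∣ j := fun h => hp.one_lt.ne' (Nat.eq_one_of_dvd_coprimes hj h hpN)
  rw [← Nat.mul_div_cancel' hd, hp.dvd_mul] at hpN
  rcases hpN with hpd | hpe
  · obtain ⟨l, -, hlj, hl⟩ := hxX p (Nat.mem_primeFactors.2 ⟨hp, hpd, hd0.ne'⟩)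
    have hlj' : (l : ZMod p) = j :=
      (ZMod.natCast_eq_natCast_iff _ _ _).2 ((pow_eq_pow_iff_modEq.1 hlj).of_dvd (hpd.trans hd))
    rw [hlj'] at hl
    rcases hl with hl | ⟨m, hm, hmp, hjm⟩
    · exact hpj ((ZMod.natCast_eq_zero_iff _ _).1 hl)
    · refine hε p m hm hmp ?_
      rw [← hjm, ← Nat.cast_add]
      exact (ZMod.natCast_eq_zero_iff _ _).2 hpt
  · have hpe' : p ∣ ∏ p ∈ (orderOf g / d).primeFactors, p :=
      Finset.dvd_prod_of_mem _ (Nat.mem_primeFactors.2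
        ⟨hp, hpe, (Nat.div_pos (Nat.le_of_dvd hN hd) hd0).ne'⟩)
    exact hpj ((Nat.dvd_add_right (hpe'.trans hdvd)).1 hpt)

/-- **Lemma 5, the numerical test.** Let `q` be odd, `g` a primitive root
of `F_q`, `P` the set of primitive roots (generators of `F_q^×`), and `d` an odd unitary
divisor of `q − 1`. Let `e` be the product of the distinct primes dividing `(q−1)/d`,
`A_d = {g^{nd} : 0 ≤ n < e}`, `S_d` the set of primes dividing `d`, and for
`ε ∈ {±1}^{S_d}` let `X_d(ε) = {x ∈ F_q^× : r_p(x) ∈ ε_p·R_p ∪ {0} for all p ∈ S_d}`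
with `r_p(x) = (log_g x) mod p` and `R_p = {1, …, (p−1)/2} ⊂ Z/pZ`. If
`{(αx+1)² − βy : x ∈ P ∩ X_d(ε), y ∈ P ∩ X_d(δ)} ⊇ F_q^×` for all `α, β ∈ A_d` and all
signs `ε, δ`, and `{x² − βy : x ∈ P, y ∈ P ∩ X_d(δ)} ⊇ F_q^×` for all `β ∈ A_d` and all
`δ`, then for all `a, b, c ∈ F_q` with `a ≠ 0`, `b² − 4ac ≠ 0` there are primitive roots
`x, y` with `y = a·x² + b·x + c`. -/
theorem stmt_15 (F : Type*) [Field F] [Fintype F] (hodd : Odd (Fintype.card F))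
    (g : Fˣ) (hg : ∀ x : Fˣ, x ∈ Subgroup.zpowers g)
    (P : Set Fˣ) (hP : P = {x : Fˣ | ∀ z : Fˣ, z ∈ Subgroup.zpowers x})
    (d : ℕ) (hd : d ∣ Fintype.card F - 1) (hdodd : Odd d)
    (hunitary : Nat.Coprime d ((Fintype.card F - 1) / d))
    (e : ℕ) (he : e = ∏ p ∈ ((Fintype.card F - 1) / d).primeFactors, p)
    (Ad : Set Fˣ) (hAd : Ad = {y : Fˣ | ∃ n < e, y = g ^ (n * d)})
    (X : (ℕ → ℤˣ) → Set Fˣ)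
    (hX : ∀ ε : ℕ → ℤˣ, X ε = {x : Fˣ | ∀ p ∈ d.primeFactors,
      ∃ n < Fintype.card F - 1, g ^ n = x ∧
        ((n : ZMod p) = 0 ∨
          ∃ m : ℕ, 1 ≤ m ∧ m ≤ (p - 1) / 2 ∧
            (n : ZMod p) = ((ε p : ℤ) : ZMod p) * (m : ZMod p))})
    (h1 : ∀ α ∈ Ad, ∀ β ∈ Ad, ∀ ε δ : ℕ → ℤˣ, ∀ γ : F, γ ≠ 0 →
      ∃ x ∈ P ∩ X ε, ∃ y ∈ P ∩ X δ,
        ((α : F) * (x : F) + 1) ^ 2 - (β : F) * (y : F) = γ)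
    (h2 : ∀ β ∈ Ad, ∀ δ : ℕ → ℤˣ, ∀ γ : F, γ ≠ 0 →
      ∃ x ∈ P, ∃ y ∈ P ∩ X δ, (x : F) ^ 2 - (β : F) * (y : F) = γ) :
    ∀ a b c : F, a ≠ 0 → b ^ 2 - 4 * a * c ≠ 0 →
      ∃ x ∈ P, ∃ y ∈ P, (y : F) = a * (x : F) ^ 2 + b * (x : F) + c := by
  classical
  have hord : orderOf g = Fintype.card F - 1 := by
    rw [orderOf_eq_card_of_forall_mem_zpowers hg, Nat.card_eq_fintype_card, Fintype.card_units]
  have key : ∀ k : Fˣ, ∃ α ∈ Ad, ∃ ε : ℕ → ℤˣ, ∀ x ∈ P ∩ X ε, k * α * x ∈ P := by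
    intro k
    rw [← hord] at hd hunitary he
    obtain ⟨n, hn, ε, h⟩ := exists_pow_exists_sign_forall_mul_generator hg hd hunitary k
    refine ⟨g ^ (n * d), hAd ▸ ⟨n, he ▸ hn, rfl⟩, ε, ?_⟩
    rintro x ⟨hxP, hxX⟩
    rw [hX ε, ← hord] at hxX
    rw [hP] at hxP ⊢
    exact h x hxP hxX
  have htwo : (2 : F) ≠ 0 := Ring.two_ne_zero fun h =>
    Nat.not_even_iff_odd.2 hodd (Nat.even_iff.2 (FiniteField.even_card_of_char_two h))
  intro a b c ha hD
  by_cases hb : b = 0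
  · subst hb
    obtain ⟨β, hβ, δ, hδ⟩ := key (Units.mk0 a ha)
    have hγ : -(c / a) ≠ 0 := by
      intro h
      apply hD
      have : c = 0 := by simpa [ha] using h
      simp [this]
    obtain ⟨x, hx, y, hy, hxy⟩ := h2 β hβ δ _ hγ
    refine ⟨x, hx, _, hδ y hy, ?_⟩
    simp only [Units.val_mul, Units.val_mk0]
    field_simp at hxy
    linear_combination -hxy
  · have hk : b / (2 * a) ≠ 0 := div_ne_zero hb (mul_ne_zero htwo ha)
    obtain ⟨α, hα, ε, hε⟩ := key (Units.mk0 _ hk)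
    obtain ⟨β, hβ, δ, hδ⟩ := key (Units.mk0 _ (mul_ne_zero ha (pow_ne_zero 2 hk)))
    obtain ⟨x, hx, y, hy, hxy⟩ := h1 α hα β hβ ε δ _ (div_ne_zero hD (pow_ne_zero 2 hb))
    refine ⟨_, hε x hx, _, hδ y hy, ?_⟩
    simp only [Units.val_mul, Units.val_mk0]
    field_simp at hxy ⊢
    linear_combination -hxy
end

section
/- For every q in the set {2, 3, 4, 5, 7, 9, 11, 13, 16, 19, 23, 25, 29, 31, 37, 41, 43, 49, 61, 67, 71, 73, 79, 121, 127, 151, 211}, there exist a, b, c ∈ F_q with a ≠ 0 and b² − 4ac ≠ 0 such that for every primitive root g of F_q, the element a·g² + b·g + c is not a primitive root of F_q. -/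
/-- A sufficient condition for `x` not to be a primitive `n`-th root of unity, where `L` is a list
of factorizations of positive integers less than `n`. The factorizations keep the evaluation of
powers cheap. -/
def IsZeroOrRootOfUnity {R : Type*} [CommRing R] (L : List (List ℕ)) (x : R) : Prop :=
  x = 0 ∨ ∃ l ∈ L, l.foldl (· ^ ·) x = 1

instance {R : Type*} [CommRing R] [DecidableEq R] (L : List (List ℕ)) (x : R) :
    Decidable (IsZeroOrRootOfUnity L x) :=
  inferInstanceAs (Decidable (_ ∨ _))

lemma List.foldl_pow {M : Type*} [Monoid M] (l : List ℕ) (x : M) :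
    l.foldl (· ^ ·) x = x ^ l.prod := by
  induction l generalizing x with
  | nil => simp
  | cons a l ih => rw [List.foldl_cons, ih, List.prod_cons, pow_mul]

lemma IsZeroOrRootOfUnity.not_isPrimitiveRoot {R : Type*} [CommRing R] [Nontrivial R]
    {L : List (List ℕ)} {n : ℕ} (hn : n ≠ 0) (hL : ∀ l ∈ L, 0 < l.prod ∧ l.prod < n) {x : R}
    (hx : IsZeroOrRootOfUnity L x) : ¬ IsPrimitiveRoot x n := by
  intro h
  rcases hx with rfl | ⟨l, hl, hxl⟩
  · exact h.ne_zero hn rfl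
  · rw [List.foldl_pow] at hxl
    exact h.pow_ne_one_of_pos_of_lt (hL l hl).1.ne' (hL l hl).2 hxl

/-- A quadratic polynomial over a finite field `K` mapping no primitive root to a primitive root
can be transported to any field of the same cardinality. -/
lemma exists_quadratic_of_card_eq {K : Type*} [CommRing K] [Fintype K] (hfield : IsField K) {q : ℕ}
    (hK : Fintype.card K = q) (L : List (List ℕ)) (hL : ∀ l ∈ L, 0 < l.prod ∧ l.prod < q - 1)
    (a b c : K) (ha : a ≠ 0) (hd : b ^ 2 - 4 * a * c ≠ 0)
    (h : ∀ x : K, IsZeroOrRootOfUnity L x ∨ IsZeroOrRootOfUnity L (a * x ^ 2 + b * x + c))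
    (F : Type*) [Field F] [Fintype F] (hF : Fintype.card F = q) :
    ∃ a b c : F, a ≠ 0 ∧ b ^ 2 - 4 * a * c ≠ 0 ∧
      ∀ g : F, IsPrimitiveRoot g (q - 1) →
        ¬ IsPrimitiveRoot (a * g ^ 2 + b * g + c) (q - 1) := by
  have hnt : Nontrivial K := hfield.nontrivial
  have e : K ≃+* F :=
    letI := hfield.toField
    FiniteField.ringEquivOfCardEq (hK.trans hF.symm)
  have hq : q - 1 ≠ 0 := by
    have := Fintype.one_lt_card (α := F)
    omega
  refine ⟨e a, e b, e c, by simpa using ha, ?_, fun g hg hg' => ?_⟩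
  · have key : e b ^ 2 - 4 * e a * e c = e (b ^ 2 - 4 * a * c) := by simp [map_ofNat]
    rwa [key, e.map_ne_zero_iff]
  · obtain ⟨x, rfl⟩ := e.surjective g
    have key : e a * e x ^ 2 + e b * e x + e c = e (a * x ^ 2 + b * x + c) := by simp
    rw [key] at hg'
    rcases h x with hx | hx
    · exact hx.not_isPrimitiveRoot hq hL (hg.of_map_of_injective e.injective)
    · exact hx.not_isPrimitiveRoot hq hL (hg'.of_map_of_injective e.injective)

lemma ZMod.isField {p : ℕ} (hp : p.Prime) : IsField (ZMod p) :=
  have : Fact p.Prime := ⟨hp⟩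
  Field.toIsField _

namespace QuadraticAlgebra

instance {R : Type*} [Fintype R] (u v : R) : Fintype (QuadraticAlgebra R u v) :=
  .ofEquiv _ (equivProd u v).symm

lemma card_eq {R : Type*} [Fintype R] (u v : R) :
    Fintype.card (QuadraticAlgebra R u v) = Fintype.card R ^ 2 := by
  rw [Fintype.card_congr (equivProd u v), Fintype.card_prod, sq]

lemma isField {k : Type*} [CommRing k] (hk : IsField k) {u v : k}
    (huv : ∀ r, r ^ 2 ≠ u + v * r) : IsField (QuadraticAlgebra k u v) :=
  letI := hk.toField
  have : Fact (∀ r, r ^ 2 ≠ u + v * r) := ⟨huv⟩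
  Field.toIsField (QuadraticAlgebra k u v)

end QuadraticAlgebra

/-- The version of `exists_quadratic_of_card_eq` for prime fields. -/
lemma exists_quadratic_of_card_eq_prime {p : ℕ} (hp : p.Prime) (L : List (List ℕ))
    (hL : ∀ l ∈ L, 0 < l.prod ∧ l.prod < p - 1) (a b c : ZMod p) (ha : a ≠ 0)
    (hd : b ^ 2 - 4 * a * c ≠ 0)
    (h : ∀ x : ZMod p, IsZeroOrRootOfUnity L x ∨ IsZeroOrRootOfUnity L (a * x ^ 2 + b * x + c))
    (F : Type*) [Field F] [Fintype F] (hF : Fintype.card F = p) :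
    ∃ a b c : F, a ≠ 0 ∧ b ^ 2 - 4 * a * c ≠ 0 ∧
      ∀ g : F, IsPrimitiveRoot g (p - 1) →
        ¬ IsPrimitiveRoot (a * g ^ 2 + b * g + c) (p - 1) :=
  have : Fact p.Prime := ⟨hp⟩
  exists_quadratic_of_card_eq (ZMod.isField hp) (ZMod.card p) L hL a b c ha hd h F hF

/-- The version of `exists_quadratic_of_card_eq` for quadratic extensions. -/
lemma exists_quadratic_of_card_eq_sq {k : Type*} [CommRing k] [Fintype k] (hk : IsField k)
    (u v : k) (huv : ∀ r, r ^ 2 ≠ u + v * r) {q : ℕ} (hq : Fintype.card k ^ 2 = q)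
    (L : List (List ℕ))
    (hL : ∀ l ∈ L, 0 < l.prod ∧ l.prod < q - 1) (a b c : QuadraticAlgebra k u v) (ha : a ≠ 0)
    (hd : b ^ 2 - 4 * a * c ≠ 0)
    (h : ∀ x : QuadraticAlgebra k u v,
      IsZeroOrRootOfUnity L x ∨ IsZeroOrRootOfUnity L (a * x ^ 2 + b * x + c))
    (F : Type*) [Field F] [Fintype F] (hF : Fintype.card F = q) :
    ∃ a b c : F, a ≠ 0 ∧ b ^ 2 - 4 * a * c ≠ 0 ∧
      ∀ g : F, IsPrimitiveRoot g (q - 1) →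
        ¬ IsPrimitiveRoot (a * g ^ 2 + b * g + c) (q - 1) :=
  exists_quadratic_of_card_eq (QuadraticAlgebra.isField hk huv)
    ((QuadraticAlgebra.card_eq u v).trans hq) L hL a b c ha hd h F hF


/-- Every `q` in the exceptional list is a genuine exception: there
exist `a, b, c ∈ F_q` with `a ≠ 0` and `b² − 4ac ≠ 0` such that for every primitive
root `g` of `F_q`, the element `a·g² + b·g + c` is not a primitive root. -/
theorem stmt_19 :
    ∀ q ∈ ({2, 3, 4, 5, 7, 9, 11, 13, 16, 19, 23, 25, 29, 31, 37, 41, 43, 49, 61, 67,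
      71, 73, 79, 121, 127, 151, 211} : Set ℕ),
    ∀ (F : Type) [Field F] [Fintype F], Fintype.card F = q →
      ∃ a b c : F, a ≠ 0 ∧ b ^ 2 - 4 * a * c ≠ 0 ∧
        ∀ g : F, IsPrimitiveRoot g (q - 1) →
          ¬ IsPrimitiveRoot (a * g ^ 2 + b * g + c) (q - 1) := by
  intro q hq F _ _ hF
  simp only [Set.mem_insert_iff, Set.mem_singleton_iff] at hq
  rcases hq with rfl | rfl | rfl | rfl | rfl | rfl | rfl | rfl | rfl | rfl | rfl | rfl | rfl | rfl |
    rfl | rfl | rfl | rfl | rfl | rfl | rfl | rfl | rfl | rfl | rfl | rfl | rfl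
  · exact exists_quadratic_of_card_eq_prime (p := 2) (by norm_num)
      [] (by decide +kernel) 1 1 0
      (by decide +kernel) (by decide +kernel) (by decide +kernel) F hF
  · exact exists_quadratic_of_card_eq_prime (p := 3) (by norm_num)
      [[1]] (by decide +kernel) 1 1 0
      (by decide +kernel) (by decide +kernel) (by decide +kernel) F hF
  · exact exists_quadratic_of_card_eq_sq (ZMod.isField (p := 2) (by norm_num)) 1 1
      (by decide +kernel) rfl
      [[1]] (by decide +kernel) ⟨1, 0⟩ ⟨1, 0⟩ ⟨0, 0⟩
      (by decide +kernel) (by decide +kernel) (by decide +kernel) F hF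
  · exact exists_quadratic_of_card_eq_prime (p := 5) (by norm_num)
      [[2]] (by decide +kernel) 1 0 1
      (by decide +kernel) (by decide +kernel) (by decide +kernel) F hF
  · exact exists_quadratic_of_card_eq_prime (p := 7) (by norm_num)
      [[3], [2]] (by decide +kernel) 1 2 0
      (by decide +kernel) (by decide +kernel) (by decide +kernel) F hF
  · exact exists_quadratic_of_card_eq_sq (ZMod.isField (p := 3) (by norm_num)) 1 1
      (by decide +kernel) rfl
      [[2, 2]] (by decide +kernel) ⟨1, 0⟩ ⟨0, 0⟩ ⟨1, 1⟩
      (by decide +kernel) (by decide +kernel) (by decide +kernel) F hF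
  · exact exists_quadratic_of_card_eq_prime (p := 11) (by norm_num)
      [[5], [2]] (by decide +kernel) 1 3 0
      (by decide +kernel) (by decide +kernel) (by decide +kernel) F hF
  · exact exists_quadratic_of_card_eq_prime (p := 13) (by norm_num)
      [[2, 3], [2, 2]] (by decide +kernel) 1 4 0
      (by decide +kernel) (by decide +kernel) (by decide +kernel) F hF
  · exact exists_quadratic_of_card_eq_sq (k := QuadraticAlgebra (ZMod 2) 1 1)
      (QuadraticAlgebra.isField (ZMod.isField Nat.prime_two) (by decide)) ⟨0, 1⟩ ⟨1, 0⟩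
      (by decide +kernel) rfl [[5], [3]] (by decide +kernel) ⟨1, 0⟩ ⟨⟨0, 1⟩, 0⟩ ⟨0, ⟨1, 1⟩⟩
      (by decide +kernel) (by decide +kernel) (by decide +kernel) F hF
  · exact exists_quadratic_of_card_eq_prime (p := 19) (by norm_num)
      [[3, 3], [2, 3]] (by decide +kernel) 1 3 1
      (by decide +kernel) (by decide +kernel) (by decide +kernel) F hF
  · exact exists_quadratic_of_card_eq_prime (p := 23) (by norm_num)
      [[11], [2]] (by decide +kernel) 20 3 17
      (by decide +kernel) (by decide +kernel) (by decide +kernel) F hF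
  · exact exists_quadratic_of_card_eq_sq (ZMod.isField (p := 5) (by norm_num)) 1 2
      (by decide +kernel) rfl
      [[2, 2, 3], [2, 2, 2]] (by decide +kernel) ⟨1, 0⟩ ⟨0, 0⟩ ⟨0, 1⟩
      (by decide +kernel) (by decide +kernel) (by decide +kernel) F hF
  · exact exists_quadratic_of_card_eq_prime (p := 29) (by norm_num)
      [[2, 7], [2, 2]] (by decide +kernel) 4 0 22
      (by decide +kernel) (by decide +kernel) (by decide +kernel) F hF
  · exact exists_quadratic_of_card_eq_prime (p := 31) (by norm_num)
      [[3, 5], [2, 5], [2, 3]] (by decide +kernel) 1 6 0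
      (by decide +kernel) (by decide +kernel) (by decide +kernel) F hF
  · exact exists_quadratic_of_card_eq_prime (p := 37) (by norm_num)
      [[2, 3, 3], [2, 2, 3]] (by decide +kernel) 1 0 6
      (by decide +kernel) (by decide +kernel) (by decide +kernel) F hF
  · exact exists_quadratic_of_card_eq_prime (p := 41) (by norm_num)
      [[2, 2, 5], [2, 2, 2]] (by decide +kernel) 4 0 12
      (by decide +kernel) (by decide +kernel) (by decide +kernel) F hF
  · exact exists_quadratic_of_card_eq_prime (p := 43) (by norm_num)
      [[3, 7], [2, 7], [2, 3]] (by decide +kernel) 1 9 0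
      (by decide +kernel) (by decide +kernel) (by decide +kernel) F hF
  · exact exists_quadratic_of_card_eq_sq (ZMod.isField (p := 7) (by norm_num)) 1 1
      (by decide +kernel) rfl
      [[2, 2, 2, 3], [2, 2, 2, 2]] (by decide +kernel) ⟨1, 0⟩ ⟨0, 0⟩ ⟨1, 3⟩
      (by decide +kernel) (by decide +kernel) (by decide +kernel) F hF
  · exact exists_quadratic_of_card_eq_prime (p := 61) (by norm_num)
      [[2, 3, 5], [2, 2, 5], [2, 2, 3]] (by decide +kernel) 1 20 2
      (by decide +kernel) (by decide +kernel) (by decide +kernel) F hF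
  · exact exists_quadratic_of_card_eq_prime (p := 67) (by norm_num)
      [[3, 11], [2, 11], [2, 3]] (by decide +kernel) 1 53 19
      (by decide +kernel) (by decide +kernel) (by decide +kernel) F hF
  · exact exists_quadratic_of_card_eq_prime (p := 71) (by norm_num)
      [[5, 7], [2, 7], [2, 5]] (by decide +kernel) 4 37 58
      (by decide +kernel) (by decide +kernel) (by decide +kernel) F hF
  · exact exists_quadratic_of_card_eq_prime (p := 73) (by norm_num)
      [[2, 2, 3, 3], [2, 2, 2, 3]] (by decide +kernel) 1 0 13
      (by decide +kernel) (by decide +kernel) (by decide +kernel) F hF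
  · exact exists_quadratic_of_card_eq_prime (p := 79) (by norm_num)
      [[3, 13], [2, 13], [2, 3]] (by decide +kernel) 3 29 11
      (by decide +kernel) (by decide +kernel) (by decide +kernel) F hF
  · exact exists_quadratic_of_card_eq_sq (ZMod.isField (p := 11) (by norm_num)) 1 2
      (by decide +kernel) rfl
      [[2, 2, 3, 5], [2, 2, 2, 5], [2, 2, 2, 3]] (by decide +kernel) ⟨0, 1⟩ ⟨2, 9⟩ ⟨2, 7⟩
      (by decide +kernel) (by decide +kernel) (by decide +kernel) F hF
  · exact exists_quadratic_of_card_eq_prime (p := 127) (by norm_num)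
      [[3, 3, 7], [2, 3, 7], [2, 3, 3]] (by decide +kernel) 30 12 11
      (by decide +kernel) (by decide +kernel) (by decide +kernel) F hF
  · exact exists_quadratic_of_card_eq_prime (p := 151) (by norm_num)
      [[3, 5, 5], [2, 5, 5], [2, 3, 5]] (by decide +kernel) 7 62 12
      (by decide +kernel) (by decide +kernel) (by decide +kernel) F hF
  · exact exists_quadratic_of_card_eq_prime (p := 211) (by norm_num)
      [[3, 5, 7], [2, 5, 7], [2, 3, 7], [2, 3, 5]] (by decide +kernel) 90 198 154
      (by decide +kernel) (by decide +kernel) (by decide +kernel) F hF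
end
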